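/- Let n ≥ 2 be an integer. There exists a function f : (1, n+1) → (0, ∞) with the following property. Let Ω̃ be a nonempty compact convex subset of the closed upper half-plane ℝ²_{≥0} = {(y₁, y₂) : y₂ ≥ 0} whose intersection with the y₁-axis is nonempty, let 1 < α < n + 1, and let δ ≥ f(α)·diam(Ω̃). Put Ω_δ = (Ω̃ + δD²) ∩ ℝ²_{≥0}, where Ω̃ + δD² = {x + u : x ∈ Ω̃, |u| ≤ δ}. Then for every point x = (ξ, 0) ∈ Ω̃ with second coordinate 0, and for every injective continuously differentiable curve γ = (γ₁, γ₂) : [0, 1] → ℝ² whose image of (0,1) equals ∂Ω_δ ∩ {y₂ > 0}, with γ₂(0) = γ₂(1) = 0 and γ₁(0) > γ₁(1), one has ∫₀¹ |x − γ(s)|^{α−n−2} (ξ − γ₁(s)) γ₂(s)^{n−2} γ₂′(s) ds < 0. -/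

import Mathlib

open MeasureTheory Pointwise

theorem integral_cos_sq_mul_sin_pow_pos (m : ℕ) :
    0 < ∫ t in (0 : ℝ)..Real.pi, Real.cos t ^ 2 * Real.sin t ^ m := by
  refine intervalIntegral.integral_pos Real.pi_pos (by fun_prop) ?_ ?_
  · intro t ht
    have := Real.sin_nonneg_of_nonneg_of_le_pi ht.1.le ht.2
    positivity
  · refine ⟨Real.pi / 4, ⟨by positivity, by linarith [Real.pi_pos]⟩, ?_⟩
    rw [Real.cos_pi_div_four, Real.sin_pi_div_four]
    positivity

/-- Near `1` the power `ρ ^ a` stays above `1 / 2` and the primitive of `t ^ (a - 1)` stays small. -/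
theorem exists_rpow_control (a ε : ℝ) (hε : 0 < ε) :
    ∃ η > 0, ∀ ρ : ℝ, 1 ≤ ρ → ρ ≤ 1 + η →
      1 / 2 ≤ ρ ^ a ∧ |∫ t in (1 : ℝ)..ρ, t ^ (a - 1)| ≤ ε := by
  have hc : ContinuousAt (fun ρ : ℝ => ρ ^ a) 1 :=
    Real.continuousAt_rpow_const _ _ (Or.inl one_ne_zero)
  obtain ⟨η₁, h₁, H₁⟩ := Metric.continuousAt_iff.1 hc (1 / 2) (by norm_num)
  have hc' : ContinuousAt (fun ρ : ℝ => ρ ^ (a - 1)) 1 :=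
    Real.continuousAt_rpow_const _ _ (Or.inl one_ne_zero)
  obtain ⟨η₂, h₂, H₂⟩ := Metric.continuousAt_iff.1 hc' 1 (by norm_num)
  refine ⟨min (min (η₁ / 2) (η₂ / 2)) (ε / 2), by positivity, fun ρ h1 hρ => ?_⟩
  have e1 : ρ ≤ 1 + η₁ / 2 := hρ.trans (by gcongr; exact (min_le_left _ _).trans (min_le_left _ _))
  have e2 : ρ ≤ 1 + η₂ / 2 := hρ.trans (by gcongr; exact (min_le_left _ _).trans (min_le_right _ _))
  have e3 : ρ ≤ 1 + ε / 2 := hρ.trans (by gcongr; exact min_le_right _ _)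
  constructor
  · have := H₁ (x := ρ) (by rw [Real.dist_eq, abs_of_nonneg (by linarith)]; linarith)
    rw [Real.dist_eq, Real.one_rpow, abs_lt] at this
    linarith
  · have hb : ∀ t ∈ Set.uIoc 1 ρ, ‖t ^ (a - 1)‖ ≤ 2 := by
      intro t ht
      rw [Set.uIoc_of_le h1] at ht
      have := H₂ (x := t) (by
        rw [Real.dist_eq, abs_of_nonneg (by linarith [ht.1])]; linarith [ht.2])
      rw [Real.dist_eq, Real.one_rpow, abs_lt] at this
      rw [Real.norm_eq_abs, abs_le]
      constructor <;> linarith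
    have := intervalIntegral.norm_integral_le_of_norm_le_const hb
    rw [Real.norm_eq_abs, abs_of_nonneg (by linarith : 0 ≤ ρ - 1)] at this
    linarith

theorem hasDerivAt_integral_rpow (b : ℝ) {ρ : ℝ} (hρ : 0 < ρ) :
    HasDerivAt (fun z : ℝ => ∫ t in (1 : ℝ)..z, t ^ b) (ρ ^ b) ρ := by
  have hc : ContinuousOn (fun t : ℝ => t ^ b) (Set.Ioi 0) := fun t ht =>
    (Real.continuousAt_rpow_const _ _ (Or.inl (ne_of_gt ht))).continuousWithinAt
  refine intervalIntegral.integral_hasDerivAt_right ?_ ?_ ?_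
  · refine (hc.mono ?_).intervalIntegrable
    intro t ht
    exact lt_of_lt_of_le (lt_min one_pos hρ) ht.1
  · exact hc.stronglyMeasurableAtFilter isOpen_Ioi _ hρ
  · exact hc.continuousAt (Ioi_mem_nhds hρ)

/-- The pointwise estimate of the integrand in polar coordinates, up to an exact derivative. -/
theorem polar_integrand_le (m : ℕ) {A g ε c s T : ℝ} (hA : 1 / 2 ≤ A) (hg : |g| ≤ ε)
    (hT : 0 ≤ T) (hs : 0 ≤ s) (hcs : s ^ 2 + c ^ 2 = 1) :
    -A * (c ^ 2 * s ^ m * T) + g * ((-s ^ (m + 2) + (m + 1) * c ^ 2 * s ^ m) * T) ≤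
      (-(1 / 2) * (c ^ 2 * s ^ m) + ε * (m + 2)) * T := by
  have hs1 : s ≤ 1 := by nlinarith [sq_nonneg c]
  have hm0 : 0 ≤ s ^ m := by positivity
  have hm1 : s ^ m ≤ 1 := pow_le_one₀ hs hs1
  have hm2 : s ^ (m + 2) ≤ 1 := pow_le_one₀ hs hs1
  have hm3 : 0 ≤ s ^ (m + 2) := by positivity
  have hc1 : c ^ 2 ≤ 1 := by nlinarith
  have hcm : c ^ 2 * s ^ m ≤ 1 := mul_le_one₀ hc1 hm0 hm1
  have hcm0 : 0 ≤ c ^ 2 * s ^ m := by positivity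
  have hk : |-s ^ (m + 2) + ((m : ℝ) + 1) * c ^ 2 * s ^ m| ≤ (m : ℝ) + 2 := by
    have : (0 : ℝ) ≤ m := by positivity
    rw [abs_le]
    constructor <;> nlinarith [mul_nonneg this hcm0, mul_le_mul_of_nonneg_left hcm this]
  have hgk : g * (-s ^ (m + 2) + ((m : ℝ) + 1) * c ^ 2 * s ^ m) ≤ ε * (m + 2) := by
    refine (le_abs_self _).trans ?_
    rw [abs_mul]
    exact mul_le_mul hg hk (abs_nonneg _) ((abs_nonneg _).trans hg)
  nlinarith [mul_le_mul_of_nonneg_right hgk hT,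
    mul_le_mul_of_nonneg_right (mul_le_mul_of_nonneg_right hA hcm0) hT]

theorem integral_neg_of_polar (m : ℕ) (a ε C : ℝ) (hC : 0 < C)
    (hε : ε * (m + 2) * Real.pi <
      1 / 2 * ∫ t in (0 : ℝ)..Real.pi, Real.cos t ^ 2 * Real.sin t ^ m)
    (ρ θ ρ' θ' φ : ℝ → ℝ)
    (hρc : ContinuousOn ρ (Set.Icc 0 1)) (hθc : ContinuousOn θ (Set.Icc 0 1))
    (hρd : ∀ s ∈ Set.Ioo (0 : ℝ) 1, HasDerivAt ρ (ρ' s) s)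
    (hθd : ∀ s ∈ Set.Ioo (0 : ℝ) 1, HasDerivAt θ (θ' s) s)
    (hρ1 : ∀ s ∈ Set.Icc (0 : ℝ) 1, 1 ≤ ρ s)
    (hρa : ∀ s ∈ Set.Icc (0 : ℝ) 1, 1 / 2 ≤ ρ s ^ a)
    (hρg : ∀ s ∈ Set.Icc (0 : ℝ) 1, |∫ t in (1 : ℝ)..ρ s, t ^ (a - 1)| ≤ ε)
    (hθ0 : θ 0 = 0) (hθ1 : θ 1 = Real.pi)
    (hθI : ∀ s ∈ Set.Icc (0 : ℝ) 1, θ s ∈ Set.Icc 0 Real.pi)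
    (hθ' : ∀ s ∈ Set.Ioo (0 : ℝ) 1, 0 ≤ θ' s)
    (hφ : IntegrableOn φ (Set.Icc 0 1))
    (hφe : ∀ s ∈ Set.Ioo (0 : ℝ) 1, φ s = -C * (ρ s ^ (a - 1) * Real.cos (θ s) *
      Real.sin (θ s) ^ m * (ρ' s * Real.sin (θ s) + ρ s * Real.cos (θ s) * θ' s))) :
    ∫ s in (0 : ℝ)..1, φ s < 0 := by
  set G : ℝ → ℝ := fun z => ∫ t in (1 : ℝ)..z, t ^ (a - 1) with hG
  set K : ℝ → ℝ := fun t => -(1 / 2) * (Real.cos t ^ 2 * Real.sin t ^ m) + ε * (m + 2) with hK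
  have hKc : Continuous K := by fun_prop
  set P : ℝ → ℝ := fun z => ∫ t in (0 : ℝ)..z, K t with hP
  have hPd : ∀ z, HasDerivAt P (K z) z := fun z =>
    (hKc.integral_hasStrictDerivAt 0 z).hasDerivAt
  have hGd : ∀ s ∈ Set.Icc (0 : ℝ) 1, HasDerivAt G (ρ s ^ (a - 1)) (ρ s) := fun s hs =>
    hasDerivAt_integral_rpow _ (by linarith [hρ1 s hs])
  set H : ℝ → ℝ := fun s =>
    C * (P (θ s) - G (ρ s) * (Real.cos (θ s) * Real.sin (θ s) ^ (m + 1))) with hH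
  have key : ∫ s in (0 : ℝ)..1, φ s ≤ H 1 - H 0 := by
    refine intervalIntegral.integral_le_sub_of_hasDeriv_right_of_le zero_le_one (g' := fun s =>
      C * (K (θ s) * θ' s - (ρ s ^ (a - 1) * ρ' s * (Real.cos (θ s) * Real.sin (θ s) ^ (m + 1)) +
        G (ρ s) * ((-Real.sin (θ s) * θ' s) * Real.sin (θ s) ^ (m + 1) + Real.cos (θ s) *
          (((m + 1 : ℕ) : ℝ) * Real.sin (θ s) ^ m * (Real.cos (θ s) * θ' s)))))) ?_ ?_ hφ ?_
    · refine continuousOn_const.mul (ContinuousOn.sub ?_ (ContinuousOn.mul ?_ ?_))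
      · exact (continuous_iff_continuousAt.2 fun z => (hPd z).continuousAt).comp_continuousOn hθc
      · intro s hs
        exact (hGd s hs).continuousAt.comp_continuousWithinAt (hρc s hs)
      · exact (Real.continuous_cos.comp_continuousOn hθc).mul
          ((Real.continuous_sin.comp_continuousOn hθc).pow _)
    · intro s hs
      have d1 := (hPd (θ s)).comp s (hθd s hs)
      have d2 := (hGd s (Set.Ioo_subset_Icc_self hs)).comp s (hρd s hs)
      have d3 := (hθd s hs).cos
      have d4 := (hθd s hs).sin.pow (m + 1)
      exact ((d1.sub (d2.mul (d3.mul d4))).const_mul C).hasDerivWithinAt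
    · intro s hs
      have hs' := Set.Ioo_subset_Icc_self hs
      have hpos : 0 < ρ s := by linarith [hρ1 s hs']
      have hsin := Real.sin_nonneg_of_nonneg_of_le_pi (hθI s hs').1 (hθI s hs').2
      have := polar_integrand_le m (hρa s hs') (hρg s hs') (hθ' s hs) hsin
        (Real.sin_sq_add_cos_sq (θ s))
      have hr : ρ s ^ a = ρ s ^ (a - 1) * ρ s := by
        rw [Real.rpow_sub_one hpos.ne']; field_simp
      rw [hφe s hs, neg_mul, ← mul_neg]
      refine mul_le_mul_of_nonneg_left ?_ hC.le
      rw [hr] at this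
      simp only [hK, hG]
      push_cast
      ring_nf at this ⊢
      linarith
  have h0 : H 0 = 0 := by simp [hH, hθ0, hP]
  have h1 : H 1 = C * P Real.pi := by simp [hH, hθ1]
  have hPpi : P Real.pi < 0 := by
    have : P Real.pi = -(1 / 2) * (∫ t in (0 : ℝ)..Real.pi, Real.cos t ^ 2 * Real.sin t ^ m) +
        ε * (m + 2) * Real.pi := by
      simp only [hP, hK]
      rw [intervalIntegral.integral_add (Continuous.intervalIntegrable (by fun_prop) _ _)
        (by simp), intervalIntegral.integral_const_mul]
      simp
      ring
    linarith
  have := mul_neg_of_pos_of_neg hC hPpi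
  linarith

theorem Convex.eq_of_mem_frontier_of_sub_eq_smul {E : Type*} [NormedAddCommGroup E]
    [NormedSpace ℝ E] {A : Set E} (hA : Convex ℝ A) {x p q : E} (hx : x ∈ interior A)
    (hp : p ∈ frontier A) (hq : q ∈ frontier A) {t : ℝ} (ht : 0 < t)
    (h : p - x = t • (q - x)) : p = q := by
  have aux : ∀ {p q : E} {t : ℝ}, p ∈ frontier A → q ∈ frontier A → 0 < t →
      p - x = t • (q - x) → ¬ t < 1 := by
    intro p q t hp hq ht h ht1
    refine hp.2 (hA.openSegment_interior_closure_subset_interior hx hq.1 ?_)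
    refine ⟨1 - t, t, by linarith, ht, by ring, ?_⟩
    rw [← sub_add_cancel p x, h, smul_sub, sub_smul, one_smul]
    abel
  rcases lt_trichotomy t 1 with h1 | h1 | h1
  · exact absurd h1 (aux hp hq ht h)
  · rw [h1, one_smul] at h
    exact sub_left_injective h
  · refine absurd (inv_lt_one_of_one_lt₀ h1) (aux hq hp (inv_pos.2 ht) ?_)
    rw [h, inv_smul_smul₀ ht.ne']

/-- A point of the upper part of the boundary of the truncation of `Ω + δD²` lies on the boundary
of `Ω + δD²`. -/
theorem mem_frontier_add_closedBall {Ω : Set (EuclideanSpace ℝ (Fin 2))}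
    {δ : ℝ} {p : EuclideanSpace ℝ (Fin 2)}
    (hp : p ∈ frontier ((Ω + Metric.closedBall (0 : EuclideanSpace ℝ (Fin 2)) δ) ∩
        {y : EuclideanSpace ℝ (Fin 2) | 0 ≤ y 1}) ∩
      {y : EuclideanSpace ℝ (Fin 2) | 0 < y 1}) :
    p ∈ frontier (Ω + Metric.closedBall (0 : EuclideanSpace ℝ (Fin 2)) δ) := by
  obtain ⟨hp, hp1⟩ := hp
  refine ⟨closure_mono Set.inter_subset_left hp.1, fun hi => hp.2 ?_⟩
  rw [interior_inter]
  refine ⟨hi, ?_⟩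
  have ho : IsOpen {y : EuclideanSpace ℝ (Fin 2) | 0 < y 1} :=
    isOpen_lt continuous_const (by fun_prop)
  refine mem_interior.2 ⟨_, ?_, ho, hp1⟩
  intro y hy
  exact le_of_lt (Set.mem_ofPred_eq ▸ hy)

theorem norm_sub_mem_Icc_of_mem_frontier_add_closedBall {E : Type*} [NormedAddCommGroup E]
    [NormedSpace ℝ E] [ProperSpace E] {Ω : Set E} (hΩ : IsCompact Ω) {δ : ℝ} {x p : E}
    (hx : x ∈ Ω) (hp : p ∈ frontier (Ω + Metric.closedBall (0 : E) δ)) :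
    ‖x - p‖ ∈ Set.Icc δ (δ + Metric.diam Ω) := by
  have hcl : IsClosed (Ω + Metric.closedBall (0 : E) δ) :=
    (hΩ.add (isCompact_closedBall _ _)).isClosed
  constructor
  · by_contra! h
    refine hp.2 (interior_maximal (t := Metric.ball x δ) ?_ Metric.isOpen_ball ?_)
    · intro y hy
      refine ⟨x, hx, y - x, ?_, by simp⟩
      rw [mem_closedBall_zero_iff, ← dist_eq_norm]
      exact (Metric.mem_ball.1 hy).le
    · rwa [Metric.mem_ball, dist_comm, dist_eq_norm]
  · obtain ⟨a, ha, b, hb, rfl⟩ := hcl.frontier_subset hp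
    have h1 := Metric.dist_le_diam_of_mem hΩ.isBounded hx ha
    rw [dist_eq_norm] at h1
    rw [mem_closedBall_zero_iff] at hb
    calc ‖x - (a + b)‖ = ‖(x - a) - b‖ := by congr 1; abel
      _ ≤ ‖x - a‖ + ‖b‖ := norm_sub_le _ _
      _ ≤ δ + Metric.diam Ω := by linarith

theorem EuclideanSpace.norm_sub_sq_fin_two (x y : EuclideanSpace ℝ (Fin 2)) (hx : x 1 = 0) :
    (y 0 - x 0) ^ 2 + (y 1) ^ 2 = ‖x - y‖ ^ 2 := by
  rw [EuclideanSpace.norm_sq_eq]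
  simp [Fin.sum_univ_two, hx]
  ring

/-- The integral over a curve in the upper half-plane that winds around `x` from right to left. -/
theorem line_integral_neg (m : ℕ) (b ε δ : ℝ) (hδ : 0 < δ)
    (hε : ε * (m + 2) * Real.pi <
      1 / 2 * ∫ t in (0 : ℝ)..Real.pi, Real.cos t ^ 2 * Real.sin t ^ m)
    (x : EuclideanSpace ℝ (Fin 2)) (hx : x 1 = 0)
    (γ : ℝ → EuclideanSpace ℝ (Fin 2)) (hγ : ContDiffOn ℝ 1 γ (Set.Icc 0 1))
    (hpos : ∀ s ∈ Set.Ioo (0 : ℝ) 1, 0 < γ s 1)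
    (hge : ∀ s ∈ Set.Icc (0 : ℝ) 1, δ ≤ ‖x - γ s‖)
    (hpow : ∀ s ∈ Set.Icc (0 : ℝ) 1, 1 / 2 ≤ (‖x - γ s‖ / δ) ^ (b + m + 2))
    (hprim : ∀ s ∈ Set.Icc (0 : ℝ) 1,
      |∫ t in (1 : ℝ)..(‖x - γ s‖ / δ), t ^ (b + m + 2 - 1)| ≤ ε)
    (hray : ∀ s ∈ Set.Icc (0 : ℝ) 1, ∀ s' ∈ Set.Icc (0 : ℝ) 1, ∀ t : ℝ, 0 < t →
      γ s - x = t • (γ s' - x) → s = s')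
    (h0 : γ 0 1 = 0) (h1 : γ 1 1 = 0) (h01 : γ 1 0 < γ 0 0) :
    (∫ s in (0:ℝ)..1, ‖x - γ s‖ ^ b * (x 0 - γ s 0) * (γ s 1) ^ m *
      deriv (fun u => γ u 1) s) < 0 := by
  set r : ℝ → ℝ := fun s => ‖x - γ s‖ with hr
  have hrpos : ∀ s ∈ Set.Icc (0 : ℝ) 1, 0 < r s := fun s hs => hδ.trans_le (hge s hs)
  have hsq : ∀ s, (γ s 0 - x 0) ^ 2 + (γ s 1) ^ 2 = r s ^ 2 := fun s =>
    EuclideanSpace.norm_sub_sq_fin_two x (γ s) hx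
  have hnn : ∀ s ∈ Set.Icc (0 : ℝ) 1, 0 ≤ γ s 1 := by
    intro s hs
    rcases eq_or_lt_of_le hs.1 with h | h
    · rw [← h, h0]
    rcases eq_or_lt_of_le hs.2 with h' | h'
    · rw [h', h1]
    exact (hpos s ⟨h, h'⟩).le
  set c : ℝ → ℝ := fun s => (γ s 0 - x 0) / r s with hc
  have hcsq : ∀ s ∈ Set.Icc (0 : ℝ) 1, c s ^ 2 + (γ s 1 / r s) ^ 2 = 1 := by
    intro s hs
    have := (hrpos s hs).ne'
    simp only [hc]
    rw [div_pow, div_pow, ← add_div, hsq, div_self (by positivity)]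
  have hcI : ∀ s ∈ Set.Icc (0 : ℝ) 1, c s ∈ Set.Icc (-1 : ℝ) 1 := by
    intro s hs
    have := hcsq s hs
    constructor <;> nlinarith [sq_nonneg (γ s 1 / r s)]
  have hγc := hγ.continuousOn
  have hγ0c : ContinuousOn (fun s => γ s 0) (Set.Icc 0 1) := by fun_prop
  have hγ1c : ContinuousOn (fun s => γ s 1) (Set.Icc 0 1) := by fun_prop
  have hrc : ContinuousOn r (Set.Icc 0 1) := (continuousOn_const.sub hγc).norm
  have hcc : ContinuousOn c (Set.Icc 0 1) :=
    (hγ0c.sub continuousOn_const).div hrc fun s hs => (hrpos s hs).ne'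
  have hinj : Set.InjOn c (Set.Icc 0 1) := by
    intro s hs s' hs' h
    have p := hrpos s hs
    have p' := hrpos s' hs'
    refine hray s hs s' hs' (r s / r s') (div_pos p p') ?_
    have e1 : γ s 1 / r s = γ s' 1 / r s' := by
      have a := hcsq s hs
      have a' := hcsq s' hs'
      rw [h] at a
      rw [← sq_eq_sq₀ (div_nonneg (hnn s hs) p.le) (div_nonneg (hnn s' hs') p'.le)]
      linarith
    simp only [hc] at h
    rw [div_eq_div_iff p.ne' p'.ne'] at h e1
    ext i
    fin_cases i
    · simp
      field_simp
      linarith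
    · simp [hx]
      field_simp
      linarith
  have m0 : (0 : ℝ) ∈ Set.Icc (0 : ℝ) 1 := by simp
  have m1 : (1 : ℝ) ∈ Set.Icc (0 : ℝ) 1 := by simp
  have hends : c 0 = 1 ∧ c 1 = -1 := by
    have q0 := hcsq 0 m0
    have q1 := hcsq 1 m1
    rw [h0, zero_div, zero_pow two_ne_zero, add_zero, sq_eq_one_iff] at q0
    rw [h1, zero_div, zero_pow two_ne_zero, add_zero, sq_eq_one_iff] at q1
    have hne : c 0 ≠ c 1 := fun h => zero_ne_one (hinj m0 m1 h)
    have p0 := hrpos 0 m0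
    have p1 := hrpos 1 m1
    rcases q0 with z0 | z0 <;> rcases q1 with z1 | z1
    · exact absurd (z0.trans z1.symm) hne
    · exact ⟨z0, z1⟩
    · simp only [hc] at z0 z1
      rw [div_eq_iff p0.ne'] at z0
      rw [div_eq_iff p1.ne'] at z1
      linarith
    · exact absurd (z0.trans z1.symm) hne
  obtain ⟨hc0, hc1⟩ := hends
  have hanti : StrictAntiOn c (Set.Icc 0 1) :=
    hcc.strictAntiOn_of_injOn_Icc zero_le_one (by rw [hc0, hc1]; norm_num) hinj
  set θ : ℝ → ℝ := fun s => Real.arccos (c s) with hθ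
  have hcos : ∀ s ∈ Set.Icc (0 : ℝ) 1, Real.cos (θ s) = c s := fun s hs =>
    Real.cos_arccos (hcI s hs).1 (hcI s hs).2
  have hsin : ∀ s ∈ Set.Icc (0 : ℝ) 1, Real.sin (θ s) = γ s 1 / r s := by
    intro s hs
    rw [hθ, Real.sin_arccos]
    have : 1 - c s ^ 2 = (γ s 1 / r s) ^ 2 := by linarith [hcsq s hs]
    rw [this, Real.sqrt_sq (div_nonneg (hnn s hs) (hrpos s hs).le)]
  have hd : ∀ s ∈ Set.Ioo (0 : ℝ) 1, DifferentiableAt ℝ γ s := fun s hs =>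
    (hγ.contDiffAt (Icc_mem_nhds hs.1 hs.2)).differentiableAt one_ne_zero
  have hd0 : ∀ s ∈ Set.Ioo (0 : ℝ) 1, DifferentiableAt ℝ (fun s => γ s 0) s := fun s hs => by
    have := hd s hs
    fun_prop
  have hrd : ∀ s ∈ Set.Ioo (0 : ℝ) 1, DifferentiableAt ℝ r s := fun s hs =>
    ((differentiableAt_const x).sub (hd s hs)).norm ℝ
      (norm_pos_iff.1 (hrpos s (Set.Ioo_subset_Icc_self hs)))
  have hcd : ∀ s ∈ Set.Ioo (0 : ℝ) 1, DifferentiableAt ℝ c s := fun s hs =>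
    ((hd0 s hs).sub_const _).div (hrd s hs) (hrpos s (Set.Ioo_subset_Icc_self hs)).ne'
  have hθd : ∀ s ∈ Set.Ioo (0 : ℝ) 1, DifferentiableAt ℝ θ s := fun s hs => by
    have hs' := Set.Ioo_subset_Icc_self hs
    have l1 := hanti m0 hs' hs.1
    have l2 := hanti hs' m1 hs.2
    rw [hc0] at l1
    rw [hc1] at l2
    exact (Real.differentiableAt_arccos.2 ⟨l2.ne', l1.ne⟩).comp s (hcd s hs)
  have hθmono : MonotoneOn θ (Set.Icc 0 1) := fun s hs s' hs' h =>
    Real.antitone_arccos (hanti.antitoneOn hs hs' h)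
  refine integral_neg_of_polar m (b + m + 2) ε (δ ^ b * δ ^ (m + 2)) (by positivity) hε
    (fun s => r s / δ) θ (fun s => deriv r s / δ) (deriv θ) _ (hrc.div_const _)
    (Real.continuous_arccos.comp_continuousOn hcc)
    (fun s hs => (hrd s hs).hasDerivAt.div_const _) (fun s hs => (hθd s hs).hasDerivAt)
    (fun s hs => (one_le_div hδ).2 (hge s hs)) hpow hprim (by simp [hθ, hc0]) (by simp [hθ, hc1])
    (fun s hs => ⟨Real.arccos_nonneg _, Real.arccos_le_pi _⟩) ?_ ?_ ?_
  · intro s hs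
    have := hθmono.derivWithin_nonneg (x := s)
    rwa [derivWithin_of_mem_nhds (Icc_mem_nhds hs.1 hs.2)] at this
  · have hγ1 : ContDiffOn ℝ 1 (fun s => γ s 1) (Set.Icc 0 1) := by fun_prop
    have hdc : ContinuousOn (derivWithin (fun s => γ s 1) (Set.Icc 0 1)) (Set.Icc 0 1) :=
      hγ1.continuousOn_derivWithin (uniqueDiffOn_Icc one_pos) le_rfl
    have hcont : ContinuousOn (fun s => r s ^ b * (x 0 - γ s 0) * (γ s 1) ^ m *
        derivWithin (fun s => γ s 1) (Set.Icc 0 1) s) (Set.Icc 0 1) := by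
      refine (((hrc.rpow_const fun s hs => Or.inl (hrpos s hs).ne').mul
        (continuousOn_const.sub hγ0c)).mul (hγ1c.pow _)).mul hdc
    have := hcont.integrableOn_compact (μ := volume) isCompact_Icc
    rw [integrableOn_Icc_iff_integrableOn_Ioo] at this ⊢
    refine this.congr_fun (fun s hs => ?_) measurableSet_Ioo
    simp only
    rw [derivWithin_of_mem_nhds (Icc_mem_nhds hs.1 hs.2)]
  · intro s hs
    have hs' := Set.Ioo_subset_Icc_self hs
    have hr0 := hrpos s hs'
    have hq : 0 < r s / δ := div_pos hr0 hδ
    have e0 : x 0 - γ s 0 = -(δ * (r s / δ) * Real.cos (θ s)) := by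
      rw [hcos s hs', hc]
      field_simp
      ring
    have e1 : γ s 1 = δ * (r s / δ) * Real.sin (θ s) := by
      rw [hsin s hs']
      field_simp
    have e2 : deriv (fun u => γ u 1) s = δ * (deriv r s / δ * Real.sin (θ s) +
        r s / δ * Real.cos (θ s) * deriv θ s) := by
      have ev : (fun u => γ u 1) =ᶠ[nhds s] fun u => r u * Real.sin (θ u) := by
        filter_upwards [Icc_mem_nhds hs.1 hs.2] with u hu
        rw [hsin u hu]
        have := hrpos u hu
        field_simp
      have hmul := (hrd s hs).hasDerivAt.fun_mul (hθd s hs).hasDerivAt.sin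
      rw [ev.deriv_eq, hmul.deriv]
      field_simp
    have e3 : ‖x - γ s‖ ^ b = δ ^ b * (r s / δ) ^ b := by
      rw [← Real.mul_rpow hδ.le hq.le, mul_div_cancel₀ _ hδ.ne']
    have e4 : (r s / δ) ^ (b + m + 2 - 1) = (r s / δ) ^ b * (r s / δ) ^ m * (r s / δ) := by
      rw [show b + m + 2 - 1 = b + m + 1 by ring, Real.rpow_add_one hq.ne', Real.rpow_add hq,
        Real.rpow_natCast]
    simp only [e4]
    rw [e2, e3, e0, e1]
    generalize r s / δ = R at *
    simp only [mul_pow]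
    ring

theorem stmt_10 (n : ℕ) (hn : 2 ≤ n) :
    ∃ f : ℝ → ℝ,
      (∀ α ∈ Set.Ioo (1 : ℝ) ((n : ℝ) + 1), 0 < f α) ∧
      ∀ Ω : Set (EuclideanSpace ℝ (Fin 2)), Ω.Nonempty → IsCompact Ω → Convex ℝ Ω →
        Ω ⊆ {y : EuclideanSpace ℝ (Fin 2) | 0 ≤ y 1} →
        (∃ p ∈ Ω, p 1 = 0) →
        ∀ α : ℝ, 1 < α → α < (n : ℝ) + 1 →
        ∀ δ : ℝ, f α * Metric.diam Ω ≤ δ →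
        ∀ x ∈ Ω, x 1 = 0 →
        ∀ γ : ℝ → EuclideanSpace ℝ (Fin 2),
          ContDiffOn ℝ 1 γ (Set.Icc 0 1) →
          Set.InjOn γ (Set.Icc 0 1) →
          γ '' Set.Ioo 0 1 =
            frontier ((Ω + Metric.closedBall (0 : EuclideanSpace ℝ (Fin 2)) δ) ∩
                {y : EuclideanSpace ℝ (Fin 2) | 0 ≤ y 1}) ∩
              {y : EuclideanSpace ℝ (Fin 2) | 0 < y 1} →
          (γ 0) 1 = 0 → (γ 1) 1 = 0 → (γ 1) 0 < (γ 0) 0 →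
          (∫ s in (0:ℝ)..1,
            ‖x - γ s‖ ^ (α - n - 2) * (x 0 - γ s 0) * (γ s 1) ^ (n - 2) *
              deriv (fun u => γ u 1) s) < 0 := by
  obtain ⟨m, rfl⟩ := Nat.exists_eq_add_of_le' hn
  set J := ∫ t in (0 : ℝ)..Real.pi, Real.cos t ^ 2 * Real.sin t ^ m with hJ
  have hJpos : 0 < J := integral_cos_sq_mul_sin_pow_pos m
  set ε : ℝ := J / (4 * (m + 2) * Real.pi) with hε
  have hpi := Real.pi_pos
  have hεpos : 0 < ε := by positivity
  have hεJ : ε * (m + 2) * Real.pi < 1 / 2 * J := by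
    have : ε * (m + 2) * Real.pi = J / 4 := by
      rw [hε]
      field_simp
    linarith
  choose η hη hctl using fun α : ℝ => exists_rpow_control (α - 2) ε hεpos
  refine ⟨fun α => 1 / η α, fun α _ => one_div_pos.2 (hη α), ?_⟩
  intro Ω _ hΩ hconv _ _ α _ _ δ hδ x hx hx1 γ hγ hinj himg h0 h1 h01
  have hdiam : Metric.diam Ω ≤ η α * δ := by
    have := mul_le_mul_of_nonneg_left hδ (hη α).le
    rwa [← mul_assoc, mul_one_div_cancel (hη α).ne', one_mul] at this
  have hup : ∀ s ∈ Set.Ioo (0 : ℝ) 1, γ s ∈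
      frontier (Ω + Metric.closedBall (0 : EuclideanSpace ℝ (Fin 2)) δ) ∧ 0 < γ s 1 := by
    intro s hs
    have := himg.subset (Set.mem_image_of_mem γ hs)
    exact ⟨mem_frontier_add_closedBall this, this.2⟩
  have hfr : ∀ s ∈ Set.Icc (0 : ℝ) 1,
      γ s ∈ frontier (Ω + Metric.closedBall (0 : EuclideanSpace ℝ (Fin 2)) δ) := by
    intro s hs
    have hcl : closure (Set.Ioo (0 : ℝ) 1) = Set.Icc 0 1 := closure_Ioo zero_ne_one
    have := ContinuousOn.image_closure (f := γ) (s := Set.Ioo 0 1) (by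
      rw [hcl]
      exact hγ.continuousOn)
    rw [hcl] at this
    refine closure_minimal ?_ isClosed_frontier (this (Set.mem_image_of_mem γ hs))
    rintro _ ⟨s, hs, rfl⟩
    exact (hup s hs).1
  have hdist : ∀ s ∈ Set.Icc (0 : ℝ) 1, ‖x - γ s‖ ∈ Set.Icc δ (δ + Metric.diam Ω) :=
    fun s hs => norm_sub_mem_Icc_of_mem_frontier_add_closedBall hΩ hx (hfr s hs)
  have hδpos : 0 < δ := by
    have hδ0 : 0 ≤ δ :=
      (mul_nonneg (one_div_pos.2 (hη α)).le Metric.diam_nonneg).trans hδ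
    refine hδ0.lt_of_ne fun h => ?_
    have hle := (hdist (1 / 2) (by norm_num)).2
    rw [← h, mul_zero] at hdiam
    have : x - γ (1 / 2) = 0 := norm_le_zero_iff.1 (by linarith)
    have hp := (hup (1 / 2) (by norm_num)).2
    rw [← sub_eq_zero.1 this, hx1] at hp
    exact lt_irrefl _ hp
  have hR : ∀ s ∈ Set.Icc (0 : ℝ) 1, 1 ≤ ‖x - γ s‖ / δ ∧ ‖x - γ s‖ / δ ≤ 1 + η α := by
    intro s hs
    refine ⟨(one_le_div hδpos).2 (hdist s hs).1, (div_le_iff₀ hδpos).2 ?_⟩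
    linarith [(hdist s hs).2]
  have hxint : x ∈ interior (Ω + Metric.closedBall (0 : EuclideanSpace ℝ (Fin 2)) δ) := by
    by_contra hni
    have hxA : x ∈ Ω + Metric.closedBall (0 : EuclideanSpace ℝ (Fin 2)) δ :=
      ⟨x, hx, 0, by simp [hδpos.le], by simp⟩
    have := (norm_sub_mem_Icc_of_mem_frontier_add_closedBall hΩ hx
      ⟨subset_closure hxA, hni⟩).1
    simp at this
    linarith
  have hAconv := hconv.add (convex_closedBall (0 : EuclideanSpace ℝ (Fin 2)) δ)
  have hb : α - ((m + 2 : ℕ) : ℝ) - 2 + m + 2 = α - 2 := by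
    push_cast
    ring
  have := line_integral_neg m (α - ((m + 2 : ℕ) : ℝ) - 2) ε δ hδpos hεJ x hx1 γ hγ
    (fun s hs => (hup s hs).2) (fun s hs => (hdist s hs).1)
    (fun s hs => hb ▸ (hctl α _ (hR s hs).1 (hR s hs).2).1)
    (fun s hs => hb ▸ (hctl α _ (hR s hs).1 (hR s hs).2).2)
    (fun s hs s' hs' t ht h => hinj hs hs'
      (hAconv.eq_of_mem_frontier_of_sub_eq_smul hxint (hfr s hs) (hfr s' hs') ht h)) h0 h1 h01
  simpa using this
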